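/- Let I_n be the edge ideal of the weighted oriented crown graph G_n with weights w_1,...,w_n ≥ 1 and n ≥ 2. Then the Castelnuovo–Mumford regularity of I_n equals w_1 + ... + w_n − n + 3. -/

import Mathlib

open MvPolynomial

/-- A (multigraded) minimal free resolution of an ideal `I ⊆ K[x_v : v ∈ σ]`,
recorded through the ranks `rk i` of its free modules, the multidegrees
`deg i j` of their basis elements, the augmentation `aug : F₀ → R` (whose image
is `I`) and the differentials `d i : F_{i+1} → F_i`, given by matrices. -/
structure MinFreeRes {K : Type} [Field K] {σ : Type} (I : Ideal (MvPolynomial σ K)) where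
  rk : ℕ → ℕ
  deg : (i : ℕ) → Fin (rk i) → (σ →₀ ℕ)
  aug : (Fin (rk 0) → MvPolynomial σ K) →ₗ[MvPolynomial σ K] MvPolynomial σ K
  d : (i : ℕ) → Matrix (Fin (rk i)) (Fin (rk (i + 1))) (MvPolynomial σ K)
  aug_homog : ∀ j, (aug (Pi.single j 1)).support ⊆ {deg 0 j}
  d_homog : ∀ i j k, ∀ m ∈ (d i j k).support, deg i j + m = deg (i + 1) k
  minimal : ∀ i j k, MvPolynomial.coeff (0 : σ →₀ ℕ) (d i j k) = 0
  range_aug : ∀ p, p ∈ LinearMap.range aug ↔ p ∈ I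
  exact_zero : LinearMap.range (Matrix.mulVecLin (d 0)) = LinearMap.ker aug
  exact_succ : ∀ i,
    LinearMap.range (Matrix.mulVecLin (d (i + 1))) = LinearMap.ker (Matrix.mulVecLin (d i))

/-- The multigraded Betti number `β_{i,a}(I)`: the number of basis elements of the
`i`-th free module in the minimal free resolution with multidegree `a`. -/
noncomputable def MinFreeRes.cnt {K : Type} [Field K] {σ : Type}
    {I : Ideal (MvPolynomial σ K)} (F : MinFreeRes I) (i : ℕ) (a : σ →₀ ℕ) : ℕ :=
  Nat.card {j : Fin (F.rk i) // F.deg i j = a}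

/-- `F` witnesses that `pdim I = p`. -/
def MinFreeRes.IsPdim {K : Type} [Field K] {σ : Type}
    {I : Ideal (MvPolynomial σ K)} (F : MinFreeRes I) (p : ℕ) : Prop :=
  F.rk p ≠ 0 ∧ ∀ i, p < i → F.rk i = 0

/-- `F` witnesses that `reg I = r`, i.e. `r = max { |a| - i : β_{i,a}(I) ≠ 0 }`. -/
def MinFreeRes.IsReg {K : Type} [Field K] {σ : Type}
    {I : Ideal (MvPolynomial σ K)} (F : MinFreeRes I) (r : ℤ) : Prop :=
  (∃ i j, ((F.deg i j).sum fun _ e => e : ℤ) - i = r) ∧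
    ∀ i j, ((F.deg i j).sum fun _ e => e : ℤ) - i ≤ r

/-- `I` is a monomial ideal. -/
def IsMonomialIdeal {K : Type} [Field K] {σ : Type} (I : Ideal (MvPolynomial σ K)) : Prop :=
  ∃ S : Set (σ →₀ ℕ), I = Ideal.span ((fun a => monomial a (1 : K)) '' S)


set_option linter.unusedSectionVars false

namespace Crown

section Koszul

variable {V : Type} [Fintype V] [DecidableEq V] {K : Type} [Field K]
variable {U : Type} [AddCommGroup U] [Module K U]
variable {W : Type} [AddCommGroup W] [Module K W]

/-- elementary sign -/
def tau (K : Type) [Field K] (ρ : V → ℕ) (u v : V) : K := if ρ v < ρ u then -1 else 1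

/-- sign of adding `u` to `σ` -/
def sg (K : Type) [Field K] (ρ : V → ℕ) (u : V) (σ : Finset V) : K := ∏ v ∈ σ, tau K ρ u v

/-- simplicial boundary -/
def bd (K : Type) [Field K] [Module K U] (ρ : V → ℕ) (f : Finset V → U) (σ : Finset V) : U :=
  ∑ v, if v ∈ σ then 0 else sg K ρ v σ • f (insert v σ)

/-- cone operator -/
def con (K : Type) [Field K] [Module K U] (ρ : V → ℕ) (v : V) (f : Finset V → U)
    (σ : Finset V) : U :=
  if v ∈ σ then sg K ρ v (σ.erase v) • f (σ.erase v) else 0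

lemma tau_sq (ρ : V → ℕ) (u v : V) : tau K ρ u v * tau K ρ u v = 1 := by
  unfold tau; split_ifs <;> simp

lemma tau_swap (ρ : V → ℕ) (hρ : Function.Injective ρ) {u v : V} (h : u ≠ v) :
    tau K ρ u v = - tau K ρ v u := by
  have : ρ u ≠ ρ v := fun e => h (hρ e)
  unfold tau
  rcases lt_or_gt_of_ne this with h1 | h1
  · simp [h1, h1.le]
  · simp [h1, h1.le]

lemma sg_sq (ρ : V → ℕ) (u : V) (σ : Finset V) : sg K ρ u σ * sg K ρ u σ = 1 := by
  unfold sg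
  rw [← Finset.prod_mul_distrib]
  exact Finset.prod_eq_one fun v _ => tau_sq ρ u v

lemma sg_insert (ρ : V → ℕ) (u v : V) (σ : Finset V) (h : v ∉ σ) :
    sg K ρ u (insert v σ) = tau K ρ u v * sg K ρ u σ := by
  unfold sg; rw [Finset.prod_insert h]

lemma bd_bd (ρ : V → ℕ) (hρ : Function.Injective ρ) (f : Finset V → U) :
    bd K ρ (bd K ρ f) = 0 := by
  funext σ
  have : bd K ρ (bd K ρ f) σ = ∑ p : V × V, if p.1 ∈ σ then 0 else sg K ρ p.1 σ •
      (if p.2 ∈ insert p.1 σ then 0 else sg K ρ p.2 (insert p.1 σ) •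
        f (insert p.2 (insert p.1 σ))) := by
    rw [Fintype.sum_prod_type]
    unfold bd
    refine Finset.sum_congr rfl fun u _ => ?_
    split_ifs
    · simp
    · rw [Finset.smul_sum]
  rw [this]
  refine Finset.sum_involution (fun p _ => p.swap) ?_ ?_ (fun _ _ => Finset.mem_univ _)
    (fun _ _ => Prod.swap_swap _)
  · rintro ⟨u, v⟩ _
    by_cases hu : u ∈ σ
    · simp [hu]
    by_cases hv : v ∈ σ
    · simp [hv]
    by_cases huv : u = v
    · subst huv; simp
    have hvu : v ≠ u := fun h => huv h.symm
    simp only [Prod.swap, hu, hv, if_false, Finset.mem_insert, huv, hvu, or_self]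
    rw [sg_insert ρ v u σ hu, sg_insert ρ u v σ hv, Finset.insert_comm v u, smul_smul, smul_smul,
      ← add_smul, tau_swap ρ hρ hvu]
    convert zero_smul K _ using 2
    ring
  · rintro ⟨u, v⟩ _ h e
    have : v = u := congrArg Prod.fst e
    subst this
    simp at h

lemma con_bd (ρ : V → ℕ) (hρ : Function.Injective ρ) (v : V) (f : Finset V → U)
    (σ : Finset V) : bd K ρ (con K ρ v f) σ = f σ - con K ρ v (bd K ρ f) σ := by
  rw [eq_sub_iff_add_eq]
  by_cases hv : v ∈ σ
  · obtain ⟨τ, hτ, rfl⟩ : ∃ τ, v ∉ τ ∧ σ = insert v τ :=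
      ⟨σ.erase v, Finset.notMem_erase _ _, (Finset.insert_erase hv).symm⟩
    unfold bd con
    rw [if_pos hv, Finset.erase_insert hτ, Finset.smul_sum, ← Finset.sum_add_distrib,
      Finset.sum_eq_single v]
    · simp [hτ, smul_smul, sg_sq]
    · intro u _ huv
      by_cases hu : u ∈ τ
      · simp [hu]
      have h1 : (insert u (insert v τ)).erase v = insert u τ := by
        rw [Finset.insert_comm, Finset.erase_insert]
        simp [hτ, huv.symm]
      simp only [Finset.mem_insert, huv, hu, or_self, if_false, true_or, or_true, if_true, h1]
      rw [sg_insert ρ u v τ hτ, sg_insert ρ v u τ hu, smul_smul, smul_smul, ← add_smul,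
        tau_swap ρ hρ huv]
      convert zero_smul K _ using 2
      have := tau_sq (K := K) ρ v u
      linear_combination (- sg K ρ u τ * sg K ρ v τ) * this
    · simp
  · unfold bd con
    rw [if_neg hv, add_zero, Finset.sum_eq_single v]
    · simp [hv, smul_smul, sg_sq]
    · intro u _ huv
      simp [hv, huv.symm]
    · simp

lemma bd_sub (ρ : V → ℕ) (f g : Finset V → U) : bd K ρ (f - g) = bd K ρ f - bd K ρ g := by
  funext σ
  simp only [bd, Pi.sub_apply, ← Finset.sum_sub_distrib]
  refine Finset.sum_congr rfl fun v _ => ?_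
  split_ifs <;> simp [smul_sub]

lemma bd_map (ρ : V → ℕ) (φ : U →ₗ[K] W) (f : Finset V → U) :
    bd K ρ (fun σ => φ (f σ)) = fun σ => φ (bd K ρ f σ) := by
  funext σ
  simp only [bd, map_sum]
  refine Finset.sum_congr rfl fun v _ => ?_
  split_ifs <;> simp

/-- a family of subspaces, antitone -/
def Anti (A : Finset V → Submodule K U) : Prop := ∀ σ v, A (insert v σ) ≤ A σ

/-- `q`-chains -/
def Chain (A : Finset V → Submodule K U) (q : ℕ) (f : Finset V → U) : Prop :=
  (∀ σ, f σ ∈ A σ) ∧ ∀ σ, σ.card ≠ q → f σ = 0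

/-- exactness in homological degree `q` -/
def Exact (ρ : V → ℕ) (A : Finset V → Submodule K U) (q : ℕ) : Prop :=
  ∀ f, Chain A q f → bd K ρ f = 0 → ∃ g, Chain A (q + 1) g ∧ bd K ρ g = f

lemma Chain.bd {ρ : V → ℕ} {A : Finset V → Submodule K U} (hA : Anti A) {q : ℕ}
    {f : Finset V → U} (hf : Chain A (q + 1) f) : Chain A q (bd K ρ f) := by
  refine ⟨fun σ => ?_, fun σ hσ => ?_⟩
  · refine Submodule.sum_mem _ fun v _ => ?_
    split_ifs
    · exact Submodule.zero_mem _
    · exact Submodule.smul_mem _ _ (hA _ _ (hf.1 _))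
  · refine Finset.sum_eq_zero fun v _ => ?_
    split_ifs with h
    · rfl
    · rw [hf.2, smul_zero]
      rw [Finset.card_insert_of_notMem h]; omega

lemma Chain.sub {A : Finset V → Submodule K U} {q : ℕ}
    {f g : Finset V → U} (hf : Chain A q f) (hg : Chain A q g) : Chain A q (f - g) :=
  ⟨fun σ => Submodule.sub_mem _ (hf.1 σ) (hg.1 σ), fun σ h => by simp [hf.2 σ h, hg.2 σ h]⟩

lemma Chain.lift {φ : U →ₗ[K] W} {B : Finset V → Submodule K U} {C : Finset V → Submodule K W}
    (hC : ∀ σ, C σ = (B σ).map φ) {q : ℕ} {f : Finset V → W} (hf : Chain C q f) :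
    ∃ g, Chain B q g ∧ ∀ σ, φ (g σ) = f σ := by
  have : ∀ σ, ∃ x, x ∈ B σ ∧ (σ.card ≠ q → x = 0) ∧ φ x = f σ := by
    intro σ
    by_cases h : σ.card = q
    · have := hf.1 σ
      rw [hC] at this
      obtain ⟨x, hx, e⟩ := this
      exact ⟨x, hx, fun h' => absurd h h', e⟩
    · exact ⟨0, Submodule.zero_mem _, fun _ => rfl, by simp [hf.2 σ h]⟩
  choose g h1 h2 h3 using this
  exact ⟨g, ⟨h1, h2⟩, h3⟩

lemma Chain.map {φ : U →ₗ[K] W} {B : Finset V → Submodule K U} {C : Finset V → Submodule K W}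
    (hC : ∀ σ, C σ = (B σ).map φ) {q : ℕ} {f : Finset V → U} (hf : Chain B q f) :
    Chain C q (fun σ => φ (f σ)) :=
  ⟨fun σ => by rw [hC]; exact Submodule.mem_map_of_mem (hf.1 σ), fun σ h => by simp [hf.2 σ h]⟩

lemma exact_of_ses_left (ρ : V → ℕ) (hρ : Function.Injective ρ) (φ : U →ₗ[K] W)
    {A B : Finset V → Submodule K U} {C : Finset V → Submodule K W}
    (hC : ∀ σ, C σ = (B σ).map φ) (hA : ∀ σ x, x ∈ A σ ↔ x ∈ B σ ∧ φ x = 0)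
    (hB : Anti B) (q : ℕ)
    (hAB : ∀ f, Chain A q f → bd K ρ f = 0 → ∃ g, Chain B (q + 1) g ∧ bd K ρ g = f)
    (hE : Exact ρ C (q + 1)) : Exact ρ A q := by
  intro f hf hbf
  obtain ⟨g, hg, rfl⟩ := hAB f hf hbf
  have h1 : bd K ρ (fun σ => φ (g σ)) = 0 := by
    rw [bd_map]; funext σ; exact ((hA _ _).1 (hf.1 σ)).2
  obtain ⟨h, hh, e⟩ := hE _ (hg.map hC) h1
  obtain ⟨k, hk, ek⟩ := hh.lift hC
  refine ⟨g - bd K ρ k, ⟨fun σ => (hA _ _).2 ⟨(hg.sub (hk.bd hB)).1 σ, ?_⟩,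
    (hg.sub (hk.bd hB)).2⟩, ?_⟩
  · have h2 := congrFun (bd_map ρ φ k) σ
    have h3 : (fun σ => φ (k σ)) = h := funext ek
    rw [h3, e] at h2
    simp only at h2
    simp [h2]
  · rw [bd_sub, bd_bd ρ hρ, sub_zero]

lemma exact_of_ses_right (ρ : V → ℕ) (hρ : Function.Injective ρ) (φ : U →ₗ[K] W)
    {A B : Finset V → Submodule K U} {C : Finset V → Submodule K W}
    (hC : ∀ σ, C σ = (B σ).map φ) (hA : ∀ σ x, x ∈ A σ ↔ x ∈ B σ ∧ φ x = 0)
    (hB : Anti B) (q : ℕ) (hEA : Exact ρ A q) (hEB : Exact ρ B (q + 1)) :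
    Exact ρ C (q + 1) := by
  intro f hf hbf
  obtain ⟨g, hg, eg⟩ := hf.lift hC
  obtain rfl : (fun σ => φ (g σ)) = f := funext eg
  have h1 : Chain A q (bd K ρ g) := by
    refine ⟨fun σ => (hA _ _).2 ⟨(hg.bd hB).1 σ, ?_⟩, (hg.bd hB).2⟩
    have := congrFun (bd_map ρ φ g) σ
    rw [hbf] at this
    exact this.symm
  obtain ⟨h, hh, e⟩ := hEA _ h1 (bd_bd ρ hρ g)
  have hh' : Chain B (q + 1) h := ⟨fun σ => ((hA _ _).1 (hh.1 σ)).1, hh.2⟩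
  obtain ⟨k, hk, ek⟩ := hEB _ (hg.sub hh') (by rw [bd_sub, e, sub_self])
  refine ⟨_, hk.map hC, ?_⟩
  rw [bd_map, ek]
  funext σ
  simp [((hA _ _).1 (hh.1 σ)).2]

/-- the family of multiples determined by a predicate -/
def predFam (K : Type) [Field K] (P : Finset V → Prop) : Finset V → Submodule K (Unit → K) :=
  fun σ => { carrier := {c | c ≠ 0 → P σ}
             zero_mem' := fun h => absurd rfl h
             add_mem' := by
               intro a b ha hb h
               by_cases h0 : a = 0
               · exact hb (by rintro rfl; exact h (by simp [h0]))
               · exact ha h0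
             smul_mem' := by
               intro c x hx h
               exact hx (by rintro rfl; exact h (by simp)) }

lemma mem_predFam {P : Finset V → Prop} {σ : Finset V} {c : Unit → K} :
    c ∈ predFam K P σ ↔ (c ≠ 0 → P σ) := Iff.rfl

lemma con_card {v : V} {ρ : V → ℕ} {q : ℕ} {f : Finset V → U}
    (hf : ∀ σ, σ.card ≠ q → f σ = 0) : ∀ σ, σ.card ≠ q + 1 → con K ρ v f σ = 0 := by
  intro σ hσ
  unfold con
  split_ifs with h
  · rw [hf, smul_zero]
    have := Finset.card_pos.2 ⟨v, h⟩
    rw [Finset.card_erase_of_mem h]; omega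
  · rfl

lemma exact_cone (ρ : V → ℕ) (hρ : Function.Injective ρ) (P : Finset V → Prop) (v : V)
    (hP : ∀ σ, v ∉ σ → P σ → P (insert v σ)) (q : ℕ) : Exact ρ (predFam K P) q := by
  intro f hf hb
  refine ⟨con K ρ v f, ⟨fun σ h => ?_, con_card hf.2⟩, ?_⟩
  · unfold con at h
    split_ifs at h with hv
    · have := hP (σ.erase v) (Finset.notMem_erase _ _)
        (hf.1 _ (by intro h0; exact h (by rw [h0, smul_zero])))
      rwa [Finset.insert_erase hv] at this
    · exact absurd rfl h
  · funext σ
    rw [con_bd ρ hρ, hb]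
    simp [con]

lemma exact_main (ρ : V → ℕ) (hρ : Function.Injective ρ) (P : Finset V → Prop)
    (S T : Finset V) (hST : Disjoint S T) (q : ℕ) (hq : q + 4 ≤ (S ∪ T).card)
    (h1 : ∀ σ, P σ → σ ⊆ S ∪ T) (h2 : ∀ σ, P σ → ¬ S ⊆ σ) (h3 : ∀ σ, P σ → ¬ T ⊆ σ)
    (h4 : ∀ σ, σ ⊆ S ∪ T → σ.card + 3 ≤ (S ∪ T).card → ¬ S ⊆ σ → ¬ T ⊆ σ → P σ) :
    Exact ρ (predFam K P) q := by
  intro f hf hb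
  have hfP : ∀ σ, ¬ P σ → f σ = 0 := fun σ h => by
    by_contra h0; exact h (hf.1 σ h0)
  by_cases hS : S = ∅
  · have : f = 0 := funext fun σ => hfP σ fun h => h2 σ h (by simp [hS])
    exact ⟨0, ⟨fun σ h => absurd rfl h, fun _ _ => rfl⟩, by subst this; funext σ; simp [bd]⟩
  by_cases hT : T = ∅
  · have : f = 0 := funext fun σ => hfP σ fun h => h3 σ h (by simp [hT])
    exact ⟨0, ⟨fun σ h => absurd rfl h, fun _ _ => rfl⟩, by subst this; funext σ; simp [bd]⟩
  obtain ⟨s, hs⟩ := Finset.nonempty_iff_ne_empty.2 hS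
  obtain ⟨t, ht⟩ := Finset.nonempty_iff_ne_empty.2 hT
  have hsT : s ∉ T := Finset.disjoint_left.1 hST hs
  have htS : t ∉ S := Finset.disjoint_right.1 hST ht
  set g := con K ρ s f with hg
  have hgW : ∀ σ, ¬ σ ⊆ S ∪ T → g σ = 0 := by
    intro σ h
    rw [hg]; unfold con
    split_ifs with h'
    · rw [hfP, smul_zero]
      intro hP
      apply h
      intro x hx
      by_cases e : x = s
      · subst e; exact Finset.mem_union_left _ hs
      · exact h1 _ hP (Finset.mem_erase.2 ⟨e, hx⟩)
    · rfl
  have hgT : ∀ σ, T ⊆ σ → g σ = 0 := by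
    intro σ h
    rw [hg]; unfold con
    split_ifs with h'
    · rw [hfP, smul_zero]
      intro hP
      exact h3 _ hP fun x hx => Finset.mem_erase.2 ⟨fun e => hsT (e ▸ hx), h hx⟩
    · rfl
  have hbg : bd K ρ g = f := by
    funext σ
    rw [hg, con_bd ρ hρ, hb]
    simp [con]
  have hgc : ∀ σ, σ.card ≠ q + 1 → g σ = 0 := con_card hf.2
  set gS : Finset V → (Unit → K) := fun σ => if S ⊆ σ then g σ else 0 with hgS
  have hgSc : ∀ σ, σ.card ≠ q + 1 → gS σ = 0 := fun σ h => by simp [hgS, hgc σ h]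
  set h := con K ρ t gS with hh
  have hhc : ∀ σ, σ.card ≠ q + 1 + 1 → h σ = 0 := con_card hgSc
  have hhS : ∀ σ, ¬ S ⊆ σ → h σ = 0 := by
    intro σ hσ
    rw [hh]; unfold con
    split_ifs
    · have : ¬ S ⊆ σ.erase t := fun e => hσ (e.trans (Finset.erase_subset _ _))
      simp [hgS, this]
    · rfl
  have hhW : ∀ σ, ¬ σ ⊆ S ∪ T → h σ = 0 := by
    intro σ hσ
    rw [hh]; unfold con
    split_ifs
    · have : ¬ σ.erase t ⊆ S ∪ T := by
        intro e
        apply hσ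
        intro x hx
        by_cases e' : x = t
        · subst e'; exact Finset.mem_union_right _ ht
        · exact e (Finset.mem_erase.2 ⟨e', hx⟩)
      simp [hgS, hgW _ this]
    · rfl
  have hbh : ∀ σ, S ⊆ σ → bd K ρ h σ = g σ := by
    intro σ hσ
    rw [hh, con_bd ρ hρ]
    have : con K ρ t (bd K ρ gS) σ = 0 := by
      unfold con
      split_ifs with htσ
      · have h5 : S ⊆ σ.erase t := fun x hx =>
          Finset.mem_erase.2 ⟨fun e => htS (e ▸ hx), hσ hx⟩
        have : bd K ρ gS (σ.erase t) = bd K ρ g (σ.erase t) := by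
          refine Finset.sum_congr rfl fun v _ => ?_
          have : S ⊆ insert v (σ.erase t) := h5.trans (Finset.subset_insert _ _)
          simp [hgS, this]
        rw [this, hbg, hfP _ fun hP => h2 _ hP h5, smul_zero]
      · rfl
    rw [this, sub_zero]
    simp [hgS, hσ]
  have hbhc : ∀ σ, σ.card ≠ q + 1 → bd K ρ h σ = 0 := by
    intro σ hσ
    refine Finset.sum_eq_zero fun v _ => ?_
    split_ifs with hv
    · rfl
    · rw [hhc, smul_zero]
      rw [Finset.card_insert_of_notMem hv]; omega
  refine ⟨g - bd K ρ h, ⟨fun σ hne => ?_, fun σ hσ => ?_⟩, ?_⟩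
  · have hc : σ.card = q + 1 := by
      by_contra hc
      exact hne (by simp [hgc σ hc, hbhc σ hc])
    refine h4 σ ?_ (by omega) ?_ ?_
    · by_contra hW
      apply hne
      have : bd K ρ h σ = 0 := by
        refine Finset.sum_eq_zero fun v _ => ?_
        split_ifs with hv
        · rfl
        · rw [hhW, smul_zero]
          exact fun e => hW ((Finset.subset_insert _ _).trans e)
      simp [hgW σ hW, this]
    · intro hσ
      exact hne (by simp [hbh σ hσ])
    · intro hσ
      apply hne
      have : bd K ρ h σ = 0 := by
        refine Finset.sum_eq_zero fun v _ => ?_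
        split_ifs with hv
        · rfl
        · rw [hhS, smul_zero]
          intro e
          have h6 : S ∪ T ⊆ insert v σ :=
            Finset.union_subset e (hσ.trans (Finset.subset_insert _ _))
          have := Finset.card_le_card h6
          rw [Finset.card_insert_of_notMem hv] at this
          omega
      simp [hgT σ hσ, this]
  · simp [hgc σ hσ, hbhc σ hσ]
  · rw [bd_sub, bd_bd ρ hρ, sub_zero, hbg]

end Koszul

section Free

variable {V : Type} [Fintype V] [DecidableEq V] {K : Type} [Field K]
variable {ι κ l : Type} [Fintype ι] [Fintype κ] [Fintype l]

/-- condition that `m + σ ≤ a` -/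
def fits (a : V →₀ ℕ) (σ : Finset V) (m : V →₀ ℕ) : Prop :=
  ∀ v, m v + (if v ∈ σ then 1 else 0) ≤ a v

lemma fits_iff (a : V →₀ ℕ) (σ : Finset V) (h : ∀ v ∈ σ, 1 ≤ a v) :
    ∃ b : V →₀ ℕ, (∀ v, b v + (if v ∈ σ then 1 else 0) = a v) ∧
      ∀ m, fits a σ m ↔ m ≤ b := by
  refine ⟨Finsupp.equivFunOnFinite.symm fun v => a v - (if v ∈ σ then 1 else 0), ?_, ?_⟩
  · intro v
    have := h v
    simp only [Finsupp.equivFunOnFinite_symm_apply_apply]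
    split_ifs with hv
    · have := h v hv; omega
    · omega
  · intro m
    rw [Finsupp.le_def]
    refine forall_congr' fun v => ?_
    simp only [Finsupp.equivFunOnFinite_symm_apply_apply]
    split_ifs with hv
    · have := h v hv; omega
    · omega

/-- the strand of a free module -/
def freeFam (K : Type) [Field K] (β : κ → V →₀ ℕ) (a : V →₀ ℕ) (σ : Finset V) :
    Submodule K (κ → K) where
  carrier := {c | ∀ k, c k ≠ 0 → fits a σ (β k)}
  zero_mem' := fun k h => absurd rfl h
  add_mem' := by
    intro x y hx hy k h
    by_cases h0 : x k = 0
    · exact hy k fun h1 => h (by simp [h0, h1])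
    · exact hx k h0
  smul_mem' := by
    intro c x hx k h
    exact hx k fun h1 => h (by simp [h1])

lemma mem_freeFam {β : κ → V →₀ ℕ} {a : V →₀ ℕ} {σ : Finset V} {c : κ → K} :
    c ∈ freeFam K β a σ ↔ ∀ k, c k ≠ 0 → fits a σ (β k) := Iff.rfl

lemma freeFam_anti (β : κ → V →₀ ℕ) (a : V →₀ ℕ) : Anti (freeFam K β a) := by
  intro σ v c hc k hk u
  have := hc k hk u
  by_cases h : u ∈ σ
  · simpa [h] using this
  · simp only [h, if_false]; omega

lemma freeFam_exact (ρ : V → ℕ) (hρ : Function.Injective ρ) (β : κ → V →₀ ℕ) (a : V →₀ ℕ)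
    (q : ℕ) (f : Finset V → κ → K) (hf : Chain (freeFam K β a) q f) (hb : bd K ρ f = 0)
    (h0 : ∀ k, β k = a → f ∅ k = 0) :
    ∃ g, Chain (freeFam K β a) (q + 1) g ∧ bd K ρ g = f := by
  have key : ∀ k, ∃ g : Finset V → K, (∀ σ, g σ ≠ 0 → fits a σ (β k)) ∧
      (∀ σ, σ.card ≠ q + 1 → g σ = 0) ∧ bd K ρ g = fun σ => f σ k := by
    intro k
    have hbk : bd K ρ (fun σ => f σ k) = 0 := by
      have := bd_map ρ (LinearMap.proj k : (κ → K) →ₗ[K] K) f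
      simp only [LinearMap.proj_apply] at this
      rw [this, hb]; rfl
    by_cases hz : ∀ σ, f σ k = 0
    · refine ⟨0, fun σ h => absurd rfl h, fun _ _ => rfl, ?_⟩
      funext σ
      simp [bd, hz]
    push Not at hz
    obtain ⟨τ, hτ⟩ := hz
    have hle : ∀ u, β k u ≤ a u := fun u => by
      have := hf.1 τ k hτ u
      omega
    have hne : ∃ v, β k v < a v := by
      by_contra hcon
      push Not at hcon
      have e : β k = a := Finsupp.ext fun u => le_antisymm (hle u) (hcon u)
      have : τ = ∅ := by
        by_contra hτ0
        obtain ⟨u, hu⟩ := Finset.nonempty_iff_ne_empty.2 hτ0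
        have h1 := hf.1 τ k hτ u
        rw [if_pos hu] at h1
        have := hcon u
        omega
      subst this
      exact hτ (h0 k e)
    obtain ⟨v, hv⟩ := hne
    refine ⟨con K ρ v (fun σ => f σ k), fun σ hσ => ?_, con_card fun σ h => by
      rw [hf.2 σ h]; rfl, ?_⟩
    · unfold con at hσ
      split_ifs at hσ with hvσ
      · intro u
        have := hf.1 (σ.erase v) k (fun e => hσ (by simp [e])) u
        by_cases e : u = v
        · subst e; rw [if_pos hvσ]; exact hv
        · simpa [e] using this
      · exact absurd rfl hσ
    · funext σ
      rw [con_bd ρ hρ, hbk]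
      simp [con]
  choose g h1 h2 h3 using key
  refine ⟨fun σ k => g k σ, ⟨fun σ k h => h1 k σ h, fun σ h => funext fun k => h2 k σ h⟩, ?_⟩
  funext σ k
  have := bd_map ρ (LinearMap.proj k : (κ → K) →ₗ[K] K) (fun σ k => g k σ)
  simp only [LinearMap.proj_apply] at this
  rw [← congrFun this σ]
  exact congrFun (h3 k) σ

/-- homogeneous matrices -/
def IsHom (α : ι → V →₀ ℕ) (β : κ → V →₀ ℕ) (M : Matrix ι κ (MvPolynomial V K)) : Prop :=
  ∀ i k, ∀ m ∈ (M i k).support, α i + m = β k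

/-- dehomogenization -/
noncomputable def ev (M : Matrix ι κ (MvPolynomial V K)) : Matrix ι κ K :=
  M.map (MvPolynomial.eval fun _ => 1)

lemma IsHom.entry {α : ι → V →₀ ℕ} {β : κ → V →₀ ℕ} {M : Matrix ι κ (MvPolynomial V K)}
    (hM : IsHom α β M) (i : ι) (k : κ) :
    M i k = monomial (β k - α i) (ev M i k) ∧ (ev M i k ≠ 0 → α i ≤ β k) := by
  have h1 : M i k = monomial (β k - α i) (coeff (β k - α i) (M i k)) := by
    apply eq_monomial_of_support_subset_singleton
    intro m hm
    rw [← hM i k m hm]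
    simp
  have h2 : ev M i k = coeff (β k - α i) (M i k) := by
    unfold ev
    rw [Matrix.map_apply]
    conv_lhs => rw [h1]
    rw [eval_monomial]
    simp
  refine ⟨by rw [h2]; exact h1, fun h => ?_⟩
  rw [h2] at h
  rw [← hM i k _ (mem_support_iff.2 h)]
  exact le_self_add

lemma IsHom.mulVec_homog {α : ι → V →₀ ℕ} {β : κ → V →₀ ℕ} {M : Matrix ι κ (MvPolynomial V K)}
    (hM : IsHom α β M) (b : V →₀ ℕ) (c : κ → K) (hc : ∀ k, c k ≠ 0 → β k ≤ b) :
    M.mulVec (fun k => monomial (b - β k) (c k)) =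
      fun i => monomial (b - α i) ((ev M).mulVec c i) := by
  funext i
  simp only [Matrix.mulVec, dotProduct, map_sum]
  refine Finset.sum_congr rfl fun k _ => ?_
  obtain ⟨h1, h2⟩ := hM.entry i k
  rw [h1, monomial_mul]
  by_cases h3 : c k = 0
  · simp [h3]
  by_cases h4 : ev M i k = 0
  · simp [h4]
  have e : β k - α i + (b - β k) = b - α i := by
    rw [add_comm]; exact tsub_add_tsub_cancel (hc k h3) (h2 h4)
  rw [e]

/-- take a graded component -/
noncomputable def comp (β : κ → V →₀ ℕ) (b : V →₀ ℕ) (d : κ → MvPolynomial V K) : κ → K :=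
  fun k => open Classical in if β k ≤ b then coeff (b - β k) (d k) else 0

lemma comp_le {β : κ → V →₀ ℕ} {b : V →₀ ℕ} {d : κ → MvPolynomial V K} {k : κ}
    (h : comp β b d k ≠ 0) : β k ≤ b := by
  by_contra h'
  simp [comp, h'] at h

lemma IsHom.mulVec_comp {α : ι → V →₀ ℕ} {β : κ → V →₀ ℕ} {M : Matrix ι κ (MvPolynomial V K)}
    (hM : IsHom α β M) (b : V →₀ ℕ) (d : κ → MvPolynomial V K) :
    (ev M).mulVec (comp β b d) = comp α b (M.mulVec d) := by
  classical
  funext i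
  have key : ∀ k, ev M i k * comp β b d k =
      if α i ≤ b then coeff (b - α i) (M i k * d k) else 0 := by
    intro k
    obtain ⟨h1, h2⟩ := hM.entry i k
    by_cases h4 : ev M i k = 0
    · rw [h1]; simp [h4]
    have h5 := h2 h4
    rw [h1, coeff_monomial_mul']
    unfold comp
    by_cases h6 : β k ≤ b
    · have h7 := h5.trans h6
      have h8 : β k - α i ≤ b - α i := tsub_le_tsub_right h6 _
      have e : b - α i - (β k - α i) = b - β k := tsub_tsub_tsub_cancel_right h5
      simp [h6, h7, h8, e]
    · by_cases h7 : α i ≤ b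
      · have h8 : ¬ β k - α i ≤ b - α i := by
          intro h
          exact h6 ((tsub_le_tsub_iff_right h7).1 h)
        simp [h6, h8]
      · simp [h6, h7]
  simp only [Matrix.mulVec, dotProduct, key]
  unfold comp
  split_ifs with h
  · simp [Matrix.mulVec, dotProduct, coeff_sum]
  · simp

lemma comp_homog (β : κ → V →₀ ℕ) (b : V →₀ ℕ) (c : κ → K) (hc : ∀ k, c k ≠ 0 → β k ≤ b) :
    comp β b (fun k => monomial (b - β k) (c k)) = c := by
  funext k
  by_cases h : β k ≤ b
  · simp [comp, h]
  · have : c k = 0 := by by_contra h0; exact h (hc k h0)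
    simp [comp, h, this]

/-- image family -/
noncomputable def imFam (M : Matrix ι κ (MvPolynomial V K)) (β : κ → V →₀ ℕ) (a : V →₀ ℕ)
    (σ : Finset V) : Submodule K (ι → K) :=
  (freeFam K β a σ).map (ev M).mulVecLin

lemma fits_pos {a m : V →₀ ℕ} {σ : Finset V} (h : fits a σ m) : ∀ v ∈ σ, 1 ≤ a v := by
  intro v hv
  have := h v
  rw [if_pos hv] at this
  omega

variable {α : ι → V →₀ ℕ} {β : κ → V →₀ ℕ} {γ : l → V →₀ ℕ}
  {M : Matrix ι κ (MvPolynomial V K)} {N : Matrix κ l (MvPolynomial V K)}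

lemma mem_imFam_iff (hM : IsHom α β M) (hN : IsHom β γ N)
    (hMN : LinearMap.range N.mulVecLin = LinearMap.ker M.mulVecLin) (a : V →₀ ℕ)
    (σ : Finset V) (x : κ → K) :
    x ∈ imFam N γ a σ ↔ x ∈ freeFam K β a σ ∧ (ev M).mulVecLin x = 0 := by
  constructor
  · rintro ⟨c, hc, rfl⟩
    constructor
    · intro k hk
      simp only [Matrix.mulVecLin_apply, Matrix.mulVec, dotProduct] at hk
      obtain ⟨j, _, hj⟩ := Finset.exists_ne_zero_of_sum_ne_zero hk
      have h1 := hc j (right_ne_zero_of_mul hj)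
      have h2 := (hN.entry k j).2 (left_ne_zero_of_mul hj)
      intro v
      have h3 := h1 v
      have h4 := h2 v
      omega
    · by_cases hσ : ∀ v ∈ σ, 1 ≤ a v
      · obtain ⟨b, -, hb⟩ := fits_iff a σ hσ
        have hc' : ∀ k, c k ≠ 0 → γ k ≤ b := fun k hk => (hb _).1 (hc k hk)
        have h1 := comp_homog γ b c hc'
        set d : l → MvPolynomial V K := fun k => monomial (b - γ k) (c k)
        have h2 : N.mulVec d ∈ LinearMap.ker M.mulVecLin := by
          rw [← hMN]; exact ⟨d, rfl⟩
        rw [LinearMap.mem_ker, Matrix.mulVecLin_apply] at h2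
        rw [← h1, Matrix.mulVecLin_apply, Matrix.mulVecLin_apply, hN.mulVec_comp, hM.mulVec_comp,
          h2]
        funext i
        simp [comp]
      · have : c = 0 := by
          funext k
          by_contra hk
          exact hσ (fits_pos (hc k hk))
        simp [this]
  · rintro ⟨hx, hx0⟩
    by_cases hσ : ∀ v ∈ σ, 1 ≤ a v
    · obtain ⟨b, -, hb⟩ := fits_iff a σ hσ
      have hc' : ∀ k, x k ≠ 0 → β k ≤ b := fun k hk => (hb _).1 (hx k hk)
      have h1 := comp_homog β b x hc'
      have h2 := hM.mulVec_homog b x hc'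
      rw [Matrix.mulVecLin_apply] at hx0
      set d : κ → MvPolynomial V K := fun k => monomial (b - β k) (x k)
      have h3 : d ∈ LinearMap.ker M.mulVecLin := by
        rw [LinearMap.mem_ker, Matrix.mulVecLin_apply, h2, hx0]
        funext i; simp
      rw [← hMN] at h3
      obtain ⟨e, he⟩ := h3
      refine ⟨comp γ b e, fun k hk => (hb _).2 (comp_le hk), ?_⟩
      rw [Matrix.mulVecLin_apply, hN.mulVec_comp, ← h1, ← he, Matrix.mulVecLin_apply]
    · have : x = 0 := by
        funext k
        by_contra hk
        exact hσ (fits_pos (hx k hk))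
      rw [this]; exact Submodule.zero_mem _

lemma imFam_min (hN : IsHom β γ N) (hmin : ∀ j k, coeff 0 (N j k) = 0) (a : V →₀ ℕ)
    (σ : Finset V) (x : κ → K) (hx : x ∈ imFam N γ a σ) (k : κ) (hk : β k = a) : x k = 0 := by
  obtain ⟨c, hc, rfl⟩ := hx
  by_contra h
  simp only [Matrix.mulVecLin_apply, Matrix.mulVec, dotProduct] at h
  obtain ⟨j, _, hj⟩ := Finset.exists_ne_zero_of_sum_ne_zero h
  have h1 := hc j (right_ne_zero_of_mul hj)
  have h2 := (hN.entry k j)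
  have h3 := h2.2 (left_ne_zero_of_mul hj)
  have h4 : γ j = β k := by
    refine le_antisymm ?_ h3
    intro v
    have := h1 v
    rw [hk]; omega
  have h5 := h2.1
  rw [h4, tsub_self] at h5
  have h6 := hmin k j
  rw [h5] at h6
  simp at h6
  exact left_ne_zero_of_mul hj h6

lemma imFam_step (ρ : V → ℕ) (hρ : Function.Injective ρ) (hM : IsHom α β M) (hN : IsHom β γ N)
    (hMN : LinearMap.range N.mulVecLin = LinearMap.ker M.mulVecLin)
    (hmin : ∀ j k, coeff 0 (N j k) = 0) (a : V →₀ ℕ) (q : ℕ) :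
    Exact ρ (imFam M β a) (q + 1) ↔ Exact ρ (imFam N γ a) q := by
  have hA := mem_imFam_iff hM hN hMN a
  constructor
  · intro h
    refine exact_of_ses_left ρ hρ (ev M).mulVecLin (B := freeFam K β a) (fun σ => rfl) hA
      (freeFam_anti β a) q ?_ h
    intro f hf hb
    exact freeFam_exact ρ hρ β a q f ⟨fun σ => ((hA σ _).1 (hf.1 σ)).1, hf.2⟩ hb
      fun k hk => imFam_min hN hmin a _ _ (hf.1 ∅) k hk
  · intro h
    refine exact_of_ses_right ρ hρ (ev M).mulVecLin (B := freeFam K β a) (fun σ => rfl) hA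
      (freeFam_anti β a) q h ?_
    intro f hf hb
    refine freeFam_exact ρ hρ β a _ f hf hb fun k hk => ?_
    rw [hf.2 ∅ (by simp)]; rfl

lemma imFam_zero (ρ : V → ℕ) (hρ : Function.Injective ρ) (hM : IsHom α β M) (hN : IsHom β γ N)
    (hMN : LinearMap.range N.mulVecLin = LinearMap.ker M.mulVecLin)
    (hmin : ∀ j k, coeff 0 (N j k) = 0) (a : V →₀ ℕ) :
    Exact ρ (imFam M β a) 0 ↔ ∀ k, β k ≠ a := by
  classical
  have hA := mem_imFam_iff hM hN hMN a
  have hC : ∀ σ, imFam M β a σ = (freeFam K β a σ).map (ev M).mulVecLin := fun σ => rfl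
  constructor
  · intro h k hk
    set f : Finset V → κ → K := fun σ => if σ = ∅ then Pi.single k 1 else 0 with hfd
    have hf : Chain (freeFam K β a) 0 f := by
      refine ⟨fun σ => ?_, fun σ hσ => ?_⟩
      · by_cases hσ : σ = ∅
        · subst hσ
          intro j hj v
          have : j = k := by
            by_contra e
            simp [hfd, e] at hj
          subst this
          simp [hk]
        · simp [hfd, hσ]
      · have : σ ≠ ∅ := fun e => hσ (by simp [e])
        simp [hfd, this]
    have hcyc : bd K ρ (fun σ => (ev M).mulVecLin (f σ)) = 0 := by
      funext σ
      refine Finset.sum_eq_zero fun v _ => ?_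
      simp [hfd]
    obtain ⟨g, hg, e⟩ := h _ (hf.map hC) hcyc
    obtain ⟨p, hp, ep⟩ := hg.lift hC
    obtain rfl : (fun σ => (ev M).mulVecLin (p σ)) = g := funext ep
    rw [bd_map] at e
    have e0 := congrFun e ∅
    have hx : (f - bd K ρ p) ∅ ∈ imFam N γ a ∅ := by
      rw [hA]
      refine ⟨(hf.sub (hp.bd (freeFam_anti β a))).1 ∅, ?_⟩
      rw [Pi.sub_apply, map_sub, e0, sub_self]
    have h1 := imFam_min hN hmin a _ _ hx k hk
    have h2 : bd K ρ p ∅ k = 0 := by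
      unfold bd
      rw [Finset.sum_apply]
      refine Finset.sum_eq_zero fun v _ => ?_
      have : p (insert v ∅) k = 0 := by
        by_contra hne
        have := hp.1 _ k hne v
        rw [hk] at this
        simp at this
      simp only [Finset.notMem_empty, if_false, Pi.smul_apply, this, smul_zero]
    simp [h2, hfd] at h1
  · intro h f hf hb
    obtain ⟨g, hg, eg⟩ := hf.lift hC
    have hbg : bd K ρ g = 0 := by
      funext σ
      refine Finset.sum_eq_zero fun v _ => ?_
      split_ifs with hv
      · rfl
      · rw [hg.2, smul_zero]
        simp [Finset.card_insert_of_notMem hv]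
    obtain ⟨p, hp, ep⟩ := freeFam_exact ρ hρ β a 0 g hg hbg fun k hk => absurd hk (h k)
    refine ⟨_, hp.map hC, ?_⟩
    rw [bd_map, ep]
    exact funext eg

/-- the augmentation matrix -/
noncomputable def augMat {I : Ideal (MvPolynomial V K)} (F : MinFreeRes I) :
    Matrix Unit (Fin (F.rk 0)) (MvPolynomial V K) := fun _ j => F.aug (Pi.single j 1)

lemma augMat_mulVec {I : Ideal (MvPolynomial V K)} (F : MinFreeRes I)
    (c : Fin (F.rk 0) → MvPolynomial V K) : (augMat F).mulVec c = fun _ => F.aug c := by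
  funext _
  have : c = ∑ j, c j • (Pi.single j 1 : Fin (F.rk 0) → MvPolynomial V K) := by
    funext i
    simp [Finset.sum_apply, Pi.single_apply]
  conv_rhs => rw [this]
  simp [Matrix.mulVec, dotProduct, augMat, mul_comm]

lemma augMat_hom {I : Ideal (MvPolynomial V K)} (F : MinFreeRes I) :
    IsHom (fun _ => 0) (F.deg 0) (augMat F) := by
  intro i k m hm
  have := F.aug_homog k hm
  simp at this
  simp [this]

lemma augMat_exact {I : Ideal (MvPolynomial V K)} (F : MinFreeRes I) :
    LinearMap.range (F.d 0).mulVecLin = LinearMap.ker (augMat F).mulVecLin := by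
  rw [F.exact_zero]
  ext c
  rw [LinearMap.mem_ker, LinearMap.mem_ker, Matrix.mulVecLin_apply, augMat_mulVec]
  constructor
  · intro h; rw [h]; rfl
  · intro h; exact congrFun h ()

lemma betti_iff (ρ : V → ℕ) (hρ : Function.Injective ρ) {I : Ideal (MvPolynomial V K)}
    (F : MinFreeRes I) (a : V →₀ ℕ) (p : ℕ) :
    Exact ρ (imFam (augMat F) (F.deg 0) a) p ↔ ∀ j, F.deg p j ≠ a := by
  have h : ∀ p i, Exact ρ (imFam (F.d i) (F.deg (i + 1)) a) p ↔
      ∀ j, F.deg (i + 1 + p) j ≠ a := by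
    intro p
    induction p with
    | zero =>
      intro i
      exact imFam_zero ρ hρ (F.d_homog i) (F.d_homog (i + 1)) (F.exact_succ i)
        (F.minimal (i + 1)) a
    | succ p ih =>
      intro i
      rw [imFam_step ρ hρ (F.d_homog i) (F.d_homog (i + 1)) (F.exact_succ i)
        (F.minimal (i + 1)) a, ih]
      have : i + 1 + 1 + p = i + 1 + (p + 1) := by omega
      rw [this]
  cases p with
  | zero => exact imFam_zero ρ hρ (augMat_hom F) (F.d_homog 0) (augMat_exact F) (F.minimal 0) a
  | succ p =>
    rw [imFam_step ρ hρ (augMat_hom F) (F.d_homog 0) (augMat_exact F) (F.minimal 0) a, h]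
    have : 0 + 1 + p = p + 1 := by omega
    rw [this]

lemma imFam_aug {I : Ideal (MvPolynomial V K)} (F : MinFreeRes I) (Q : (V →₀ ℕ) → Prop)
    (hQ : ∀ b, monomial b (1 : K) ∈ I ↔ Q b) (hQm : ∀ b c, b ≤ c → Q b → Q c) (a : V →₀ ℕ) :
    imFam (augMat F) (F.deg 0) a = predFam K fun σ => ∃ b, fits a σ b ∧ Q b := by
  funext σ
  ext x
  constructor
  · rintro ⟨c, hc, rfl⟩ h
    have h0 : (ev (augMat F)).mulVec c () ≠ 0 := fun e => h (funext fun _ => e)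
    simp only [Matrix.mulVec, dotProduct] at h0
    obtain ⟨j, _, hj⟩ := Finset.exists_ne_zero_of_sum_ne_zero h0
    refine ⟨F.deg 0 j, hc j (right_ne_zero_of_mul hj), (hQ _).1 ?_⟩
    have h1 := ((augMat_hom F).entry () j).1
    have h2 : augMat F () j ∈ I := (F.range_aug _).1 ⟨_, rfl⟩
    have h3 := left_ne_zero_of_mul hj
    rw [h1, tsub_zero] at h2
    have := I.mul_mem_left (C (ev (augMat F) () j)⁻¹) h2
    rwa [C_mul_monomial, inv_mul_cancel₀ h3] at this
  · intro h
    by_cases hx : x = 0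
    · rw [hx]; exact Submodule.zero_mem _
    obtain ⟨b', hb', hQb⟩ := h hx
    obtain ⟨b, -, hb⟩ := fits_iff a σ (fits_pos hb')
    have h1 : monomial b (x ()) ∈ I := by
      have := I.mul_mem_left (C (x ())) ((hQ b).2 (hQm _ _ ((hb _).1 hb') hQb))
      rwa [C_mul_monomial, mul_one] at this
    obtain ⟨d, hd⟩ := (F.range_aug _).2 h1
    refine ⟨comp (F.deg 0) b d, fun k hk => (hb _).2 (comp_le hk), ?_⟩
    rw [Matrix.mulVecLin_apply, (augMat_hom F).mulVec_comp, augMat_mulVec, hd]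
    funext u
    simp [comp]

end Free

section Lower

variable {V : Type} [Fintype V] [DecidableEq V] {K : Type} [Field K]
variable {U : Type} [AddCommGroup U] [Module K U]

lemma bd_pair (ρ : V → ℕ) (hρ : Function.Injective ρ) (h : Finset V → U) (u v : V)
    (huv : u ≠ v) : bd K ρ h ((Finset.univ.erase u).erase v) = 0 ↔
      sg K ρ u (Finset.univ.erase u) • h (Finset.univ.erase u) =
        sg K ρ v (Finset.univ.erase v) • h (Finset.univ.erase v) := by
  set σ : Finset V := (Finset.univ.erase u).erase v with hσ
  have hu : u ∉ σ := by simp [hσ]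
  have hv : v ∉ σ := by simp [hσ]
  have e1 : Finset.univ.erase u = insert v σ := by ext z; simp [hσ]; grind
  have e2 : Finset.univ.erase v = insert u σ := by ext z; simp [hσ]; grind
  have hb : bd K ρ h σ = sg K ρ u σ • h (insert u σ) + sg K ρ v σ • h (insert v σ) := by
    unfold bd
    rw [Finset.sum_eq_add u v huv]
    · simp [hu, hv]
    · rintro z - ⟨h1, h2⟩
      have : z ∈ σ := by simp [hσ, h1, h2]
      simp [this]
    · simp
    · simp
  rw [hb, e1, e2, sg_insert ρ u v σ hv, sg_insert ρ v u σ hu, tau_swap ρ hρ huv.symm]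
  have hsu := sg_sq (K := K) ρ u σ
  have hsv := sg_sq (K := K) ρ v σ
  have ht := tau_sq (K := K) ρ u v
  set A := sg K ρ u σ
  set B := sg K ρ v σ
  set t := tau K ρ u v
  constructor
  · intro h0
    have h1 : (t * A * B) • (A • h (insert u σ) + B • h (insert v σ)) = 0 := by
      rw [h0, smul_zero]
    rw [smul_add, smul_smul, smul_smul] at h1
    have e3 : t * A * B * A = t * B := by linear_combination t * B * hsu
    have e4 : t * A * B * B = t * A := by linear_combination t * A * hsv
    rw [e3, e4] at h1
    rw [neg_mul, neg_smul, eq_neg_iff_add_eq_zero, add_comm]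
    exact h1
  · intro h0
    rw [neg_mul, neg_smul, eq_neg_iff_add_eq_zero] at h0
    have h1 : (t * A * B) • ((t * A) • h (insert v σ) + (t * B) • h (insert u σ)) = 0 := by
      rw [h0, smul_zero]
    rw [smul_add, smul_smul, smul_smul] at h1
    have e3 : t * A * B * (t * A) = B := by
      linear_combination (A * A * B) * ht + B * hsu
    have e4 : t * A * B * (t * B) = A := by
      linear_combination (A * B * B) * ht + A * hsv
    rw [e3, e4, add_comm] at h1
    exact h1

lemma not_exact (ρ : V → ℕ) (hρ : Function.Injective ρ) (P : Finset V → Prop) (q : ℕ)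
    (hq : Fintype.card V = q + 3) (x₀ x₁ y₀ y₁ : V) (h1 : x₀ ≠ x₁) (h2 : x₁ ≠ y₁) (h3 : y₁ ≠ y₀)
    (h4 : x₀ ≠ y₀) (h5 : x₁ ≠ y₀) (h6 : x₀ ≠ y₁)
    (p1 : ¬ P ((Finset.univ.erase x₀).erase x₁)) (p2 : ¬ P ((Finset.univ.erase x₁).erase y₁))
    (p3 : ¬ P ((Finset.univ.erase y₁).erase y₀)) (p4 : ¬ P ((Finset.univ.erase x₀).erase y₀))
    (hP : ∀ σ : Finset V, σ.card = q → x₀ ∉ σ → y₀ ∉ σ → P σ) :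
    ¬ Exact ρ (predFam K P) q := by
  intro hE
  set τ : Finset V := (Finset.univ.erase x₀).erase y₀ with hτ
  have hτc : τ.card = q + 1 := by
    rw [hτ, Finset.card_erase_of_mem (by simp [h4.symm]), Finset.card_erase_of_mem (by simp),
      Finset.card_univ]
    omega
  set g : Finset V → Unit → K := fun σ => if σ = τ then 1 else 0 with hg
  have hz : ∀ σ, bd K ρ g σ ≠ 0 → σ.card = q ∧ x₀ ∉ σ ∧ y₀ ∉ σ := by
    intro σ hσ
    obtain ⟨v, -, hv⟩ := Finset.exists_ne_zero_of_sum_ne_zero hσ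
    split_ifs at hv with hvσ
    · exact absurd rfl hv
    · have e : insert v σ = τ := by
        by_contra e
        simp [hg, e] at hv
      refine ⟨?_, ?_, ?_⟩
      · rw [← e, Finset.card_insert_of_notMem hvσ] at hτc; omega
      · intro hx
        have : x₀ ∈ τ := e ▸ Finset.mem_insert_of_mem hx
        simp [hτ] at this
      · intro hx
        have : y₀ ∈ τ := e ▸ Finset.mem_insert_of_mem hx
        simp [hτ] at this
  obtain ⟨g', hg', e⟩ := hE (bd K ρ g) ⟨fun σ h => by
      obtain ⟨a, b, c⟩ := hz σ h
      exact hP σ a b c, fun σ hσ => by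
      by_contra h
      exact hσ (hz σ h).1⟩ (bd_bd ρ hρ g)
  set h := con K ρ x₀ (g - g') with hh
  have hbh : bd K ρ h = g - g' := by
    funext σ
    rw [hh, con_bd ρ hρ, bd_sub, e, sub_self]
    simp [con]
  have hg'0 : ∀ σ, ¬ P σ → g' σ = 0 := fun σ h => by
    by_contra h0; exact h (hg'.1 σ h0)
  have ne : ∀ σ z, z ∈ σ → z ∉ τ → g σ = 0 := by
    intro σ z hz hz'
    have : σ ≠ τ := fun e => hz' (e ▸ hz)
    simp [hg, this]
  have a1 := (bd_pair ρ hρ h x₀ x₁ h1).1 (by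
    rw [hbh, Pi.sub_apply, hg'0 _ p1, ne _ y₀ (by simp [h4.symm, h5.symm]) (by simp [hτ]),
      sub_zero])
  have a2 := (bd_pair ρ hρ h x₁ y₁ h2).1 (by
    rw [hbh, Pi.sub_apply, hg'0 _ p2, ne _ y₀ (by simp [h3.symm, h5.symm]) (by simp [hτ]),
      sub_zero])
  have a3 := (bd_pair ρ hρ h y₁ y₀ h3).1 (by
    rw [hbh, Pi.sub_apply, hg'0 _ p3, ne _ x₀ (by simp [h4, h6]) (by simp [hτ]),
      sub_zero])
  have a4 := (bd_pair ρ hρ h x₀ y₀ h4).2 (a1.trans (a2.trans a3))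
  rw [hbh, Pi.sub_apply, hg'0 _ p4] at a4
  simp [hg, ← hτ] at a4

end Lower

section Final

variable {K : Type} [Field K] {n : ℕ}

/-- membership of monomials -/
def Q (w : Fin n → ℕ) (b : (Fin n ⊕ Fin n) →₀ ℕ) : Prop :=
  ∃ i j : Fin n, i ≠ j ∧ 1 ≤ b (Sum.inl i) ∧ w j ≤ b (Sum.inr j)

lemma mem_I_iff (w : Fin n → ℕ) (b : (Fin n ⊕ Fin n) →₀ ℕ) :
    monomial b (1 : K) ∈ Ideal.span {p : MvPolynomial (Fin n ⊕ Fin n) K | ∃ i j : Fin n, i ≠ j ∧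
      p = X (Sum.inl i) * X (Sum.inr j) ^ w j} ↔ Q w b := by
  classical
  have : {p : MvPolynomial (Fin n ⊕ Fin n) K | ∃ i j : Fin n, i ≠ j ∧
      p = X (Sum.inl i) * X (Sum.inr j) ^ w j} = (fun s => monomial s (1 : K)) ''
      {s | ∃ i j : Fin n, i ≠ j ∧
        s = Finsupp.single (Sum.inl i) 1 + Finsupp.single (Sum.inr j) (w j)} := by
    ext p
    constructor
    · rintro ⟨i, j, hij, rfl⟩
      refine ⟨_, ⟨i, j, hij, rfl⟩, ?_⟩
      simp only [X_pow_eq_monomial]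
      rw [X, monomial_mul, mul_one]
    · rintro ⟨_, ⟨i, j, hij, rfl⟩, rfl⟩
      refine ⟨i, j, hij, ?_⟩
      rw [X_pow_eq_monomial, X, monomial_mul, mul_one]
  rw [this, mem_ideal_span_monomial_image]
  have hs : (monomial b (1 : K)).support = {b} := by
    rw [support_monomial, if_neg one_ne_zero]
  rw [hs]
  simp only [Finset.mem_singleton, forall_eq, Set.mem_setOf_eq]
  constructor
  · rintro ⟨_, ⟨i, j, hij, rfl⟩, hle⟩
    refine ⟨i, j, hij, ?_, ?_⟩
    · simpa using hle (Sum.inl i)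
    · simpa using hle (Sum.inr j)
  · rintro ⟨i, j, hij, h1, h2⟩
    refine ⟨_, ⟨i, j, hij, rfl⟩, ?_⟩
    rintro (v | v)
    · by_cases e : i = v
      · subst e; simpa using h1
      · simp [Finsupp.single_apply, e]
    · by_cases e : j = v
      · subst e; simpa using h2
      · simp [Finsupp.single_apply, e]

/-- explicit form of the upper Koszul complex -/
def PP (w : Fin n → ℕ) (a : (Fin n ⊕ Fin n) →₀ ℕ) (σ : Finset (Fin n ⊕ Fin n)) : Prop :=
  (∀ v ∈ σ, 1 ≤ a v) ∧ ∃ i j : Fin n, i ≠ j ∧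
    1 + (if Sum.inl i ∈ σ then 1 else 0) ≤ a (Sum.inl i) ∧
    w j + (if Sum.inr j ∈ σ then 1 else 0) ≤ a (Sum.inr j)

lemma PP_iff (w : Fin n → ℕ) (a : (Fin n ⊕ Fin n) →₀ ℕ) (σ : Finset (Fin n ⊕ Fin n)) :
    (∃ b, fits a σ b ∧ Q w b) ↔ PP w a σ := by
  constructor
  · rintro ⟨b, hb, i, j, hij, h1, h2⟩
    refine ⟨fits_pos hb, i, j, hij, ?_, ?_⟩
    · have := hb (Sum.inl i); omega
    · have := hb (Sum.inr j); omega
  · rintro ⟨h, i, j, hij, h1, h2⟩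
    obtain ⟨b, hb, hb'⟩ := fits_iff a σ h
    refine ⟨b, (hb' b).2 le_rfl, i, j, hij, ?_, ?_⟩
    · have := hb (Sum.inl i); omega
    · have := hb (Sum.inr j); omega

lemma betti_iff' (w : Fin n → ℕ) (ρ : Fin n ⊕ Fin n → ℕ) (hρ : Function.Injective ρ)
    {I : Ideal (MvPolynomial (Fin n ⊕ Fin n) K)}
    (hI : I = Ideal.span {p | ∃ i j : Fin n, i ≠ j ∧
      p = X (Sum.inl i) * X (Sum.inr j) ^ w j})
    (F : MinFreeRes I) (a : (Fin n ⊕ Fin n) →₀ ℕ) (p : ℕ) :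
    Exact ρ (predFam K (PP w a)) p ↔ ∀ j, F.deg p j ≠ a := by
  rw [← betti_iff ρ hρ F a p, imFam_aug F (Q w) (fun b => by rw [hI]; exact mem_I_iff w b)]
  · have : PP w a = fun σ => ∃ b, fits a σ b ∧ Q w b := by
      funext σ; exact propext (PP_iff w a σ).symm
    rw [this]
  · rintro b c hbc ⟨i, j, hij, h1, h2⟩
    exact ⟨i, j, hij, h1.trans (hbc _), h2.trans (hbc _)⟩

lemma upper (w : Fin n → ℕ) (hw : ∀ j, 1 ≤ w j) (ρ : Fin n ⊕ Fin n → ℕ)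
    (hρ : Function.Injective ρ) (a : (Fin n ⊕ Fin n) →₀ ℕ) (q : ℕ)
    (h : (∑ j, (w j : ℤ)) - n + 3 < (∑ v, (a v : ℤ)) - q) :
    Exact ρ (predFam K (PP w a)) q := by
  classical
  by_cases hx : ∃ i, 2 ≤ a (Sum.inl i)
  · obtain ⟨i, hi⟩ := hx
    refine exact_cone ρ hρ _ (Sum.inl i) ?_ q
    rintro σ hσ ⟨h1, i', j, hij, h2, h3⟩
    refine ⟨?_, i', j, hij, ?_, ?_⟩
    · intro v hv
      rcases Finset.mem_insert.1 hv with rfl | hv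
      · omega
      · exact h1 v hv
    · by_cases e : i' = i
      · subst e; simp; omega
      · simpa [e] using h2
    · simpa using h3
  by_cases hy : ∃ j, a (Sum.inr j) ≠ 0 ∧ a (Sum.inr j) ≠ w j
  · obtain ⟨j, hj0, hj⟩ := hy
    refine exact_cone ρ hρ _ (Sum.inr j) ?_ q
    rintro σ hσ ⟨h1, i, j', hij, h2, h3⟩
    refine ⟨?_, i, j', hij, ?_, ?_⟩
    · intro v hv
      rcases Finset.mem_insert.1 hv with rfl | hv
      · omega
      · exact h1 v hv
    · simpa using h2
    · by_cases e : j' = j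
      · subst e; simp [hσ] at h3 ⊢; omega
      · simpa [e] using h3
  push Not at hx hy
  set S : Finset (Fin n ⊕ Fin n) := Finset.univ.filter fun v => a v ≠ 0 ∧ v.isLeft = true with hS
  set T : Finset (Fin n ⊕ Fin n) := Finset.univ.filter fun v => a v ≠ 0 ∧ v.isRight = true with hT
  have hW : ∀ v, v ∈ S ∪ T ↔ a v ≠ 0 := by
    rintro (v | v) <;> simp [hS, hT]
  have hSl : ∀ i, Sum.inl i ∈ S ↔ a (Sum.inl i) ≠ 0 := by simp [hS]
  have hSr : ∀ i, Sum.inr i ∉ S := by simp [hS]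
  have hTr : ∀ i, Sum.inr i ∈ T ↔ a (Sum.inr i) ≠ 0 := by simp [hT]
  have hTl : ∀ i, Sum.inl i ∉ T := by simp [hT]
  refine exact_main ρ hρ _ S T ?_ q ?_ ?_ ?_ ?_ ?_
  · rw [Finset.disjoint_left]
    rintro (v | v) h1 h2
    · exact hTl v h2
    · exact hSr v h1
  · have hc : ((S ∪ T).card : ℤ) = ∑ v, if a v ≠ 0 then (1 : ℤ) else 0 := by
      have : S ∪ T = Finset.univ.filter fun v => a v ≠ 0 := by
        ext v; rw [hW]; simp
      rw [this, Finset.card_filter]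
      push_cast
      rfl
    rw [Fintype.sum_sum_type] at h hc
    have b1 : ∑ i : Fin n, (a (Sum.inl i) : ℤ) ≤
        ∑ i : Fin n, if a (Sum.inl i) ≠ 0 then (1 : ℤ) else 0 := by
      refine Finset.sum_le_sum fun i _ => ?_
      have := hx i
      split_ifs with h0
      · omega
      · simp at h0; simp [h0]
    have b2 : ∑ j : Fin n, (a (Sum.inr j) : ℤ) ≤
        ∑ j : Fin n, ((if a (Sum.inr j) ≠ 0 then (1 : ℤ) else 0) + ((w j : ℤ) - 1)) := by
      refine Finset.sum_le_sum fun j _ => ?_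
      have h1 := hy j
      have h2 := hw j
      split_ifs with h0
      · rw [h1 h0]; omega
      · simp at h0; simp [h0]; omega
    rw [Finset.sum_add_distrib, Finset.sum_sub_distrib] at b2
    simp at b2 b1 hc
    omega
  · intro σ hσ v hv
    rw [hW]
    have := hσ.1 v hv
    omega
  · rintro σ ⟨h1, i, j, hij, h2, h3⟩ hsub
    have := hx i
    have h4 : Sum.inl i ∈ σ := hsub ((hSl i).2 (by omega))
    rw [if_pos h4] at h2
    omega
  · rintro σ ⟨h1, i, j, hij, h2, h3⟩ hsub
    have h5 := hw j
    have h6 : a (Sum.inr j) ≠ 0 := by omega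
    have h4 : Sum.inr j ∈ σ := hsub ((hTr j).2 h6)
    rw [if_pos h4, hy j h6] at h3
    omega
  · intro σ hσ hc hnS hnT
    refine ⟨fun v hv => Nat.one_le_iff_ne_zero.2 ((hW v).1 (hσ hv)), ?_⟩
    have good : ∀ i j, i ≠ j → Sum.inl i ∈ S → Sum.inl i ∉ σ → Sum.inr j ∈ T → Sum.inr j ∉ σ →
        ∃ i j : Fin n, i ≠ j ∧
        1 + (if Sum.inl i ∈ σ then 1 else 0) ≤ a (Sum.inl i) ∧
        w j + (if Sum.inr j ∈ σ then 1 else 0) ≤ a (Sum.inr j) := by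
      intro i j hij h1 h2 h3 h4
      refine ⟨i, j, hij, ?_, ?_⟩
      · have := (hSl i).1 h1
        simp [h2]; omega
      · have := (hTr j).1 h3
        simp [h4, hy j this]
    rw [Finset.not_subset] at hnS hnT
    obtain ⟨x, hxS, hxσ⟩ := hnS
    obtain ⟨y, hyT, hyσ⟩ := hnT
    rcases x with i | i
    swap
    · exact absurd hxS (hSr i)
    rcases y with j | j
    · exact absurd hyT (hTl j)
    by_cases hij : i = j
    · subst hij
      obtain ⟨z, hz, hz'⟩ : ∃ z ∈ S ∪ T, z ∉ insert (Sum.inl i) (insert (Sum.inr i) σ) := by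
        apply Finset.exists_mem_notMem_of_card_lt_card
        have h1 := Finset.card_insert_le (Sum.inl i) (insert (Sum.inr i) σ)
        have h2 := Finset.card_insert_le (Sum.inr i) σ
        omega
      simp only [Finset.mem_insert, not_or] at hz'
      obtain ⟨z1, z2, z3⟩ := hz'
      rcases z with k | k
      · exact good k i (fun e => z1 (by rw [e])) ((hSl k).2 ((hW _).1 hz)) z3 hyT hyσ
      · exact good i k (fun e => z2 (by rw [e])) hxS hxσ ((hTr k).2 ((hW _).1 hz)) z3
    · exact good i j hij hxS hxσ hyT hyσ

lemma lower (hn : 2 ≤ n) (w : Fin n → ℕ) (hw : ∀ j, 1 ≤ w j) (ρ : Fin n ⊕ Fin n → ℕ)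
    (hρ : Function.Injective ρ) (a : (Fin n ⊕ Fin n) →₀ ℕ) (q : ℕ) (hq : q + 3 = 2 * n)
    (ha1 : ∀ i, a (Sum.inl i) = 1) (ha2 : ∀ j, a (Sum.inr j) = w j) :
    ¬ Exact ρ (predFam K (PP w a)) q := by
  have key : ∀ σ, PP w a σ ↔ ∃ i j : Fin n, i ≠ j ∧ Sum.inl i ∉ σ ∧ Sum.inr j ∉ σ := by
    intro σ
    constructor
    · rintro ⟨-, i, j, hij, h1, h2⟩
      refine ⟨i, j, hij, ?_, ?_⟩
      · intro h; rw [if_pos h, ha1] at h1; omega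
      · intro h; rw [if_pos h, ha2] at h2; omega
    · rintro ⟨i, j, hij, h1, h2⟩
      refine ⟨?_, i, j, hij, ?_, ?_⟩
      · rintro (v | v) _
        · rw [ha1]
        · rw [ha2]; exact hw v
      · simp [h1, ha1]
      · simp [h2, ha2]
  set z : Fin n := ⟨0, by omega⟩
  set o : Fin n := ⟨1, by omega⟩
  have hzo : z ≠ o := by simp [z, o]
  refine not_exact ρ hρ _ q (by simp; omega) (Sum.inl z) (Sum.inl o) (Sum.inr z) (Sum.inr o)
    (by simp [hzo]) (by simp) (by simp [hzo.symm]) (by simp) (by simp) (by simp) ?_ ?_ ?_ ?_ ?_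
  · rw [key]; simp
  · rw [key]; simp
  · rw [key]; simp
  · rw [key]; simp
  · intro σ hσ h1 h2
    rw [key]
    obtain ⟨v, hv, hv'⟩ : ∃ v ∈ (Finset.univ : Finset (Fin n ⊕ Fin n)),
        v ∉ insert (Sum.inl z) (insert (Sum.inr z) σ) := by
      apply Finset.exists_mem_notMem_of_card_lt_card
      have h1 := Finset.card_insert_le (Sum.inl z) (insert (Sum.inr z) σ)
      have h2 := Finset.card_insert_le (Sum.inr z) σ
      have h3 : (Finset.univ : Finset (Fin n ⊕ Fin n)).card = n + n := by simp
      omega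
    simp only [Finset.mem_insert, not_or] at hv'
    obtain ⟨z1, z2, z3⟩ := hv'
    rcases v with k | k
    · exact ⟨k, z, fun e => z1 (by rw [e]), z3, h2⟩
    · exact ⟨z, k, fun e => z2 (by rw [e]), h1, z3⟩

end Final

end Crown

/-- For the edge ideal `I_n` of the weighted oriented crown graph `G_n` (`n ≥ 2`)
with weights `w_1,…,w_n ≥ 1`, the Castelnuovo–Mumford regularity of `I_n` is
`w_1 + ⋯ + w_n - n + 3`. -/
theorem stmt18 {K : Type} [Field K] (n : ℕ) (hn : 2 ≤ n)
    (w : Fin n → ℕ) (hw : ∀ j, 1 ≤ w j)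
    (I : Ideal (MvPolynomial (Fin n ⊕ Fin n) K))
    (hI : I = Ideal.span {p | ∃ i j : Fin n, i ≠ j ∧
      p = X (Sum.inl i) * X (Sum.inr j) ^ w j})
    (F : MinFreeRes I) :
    F.IsReg ((∑ j, (w j : ℤ)) - n + 3) := by
  classical
  obtain ⟨ρ, hρ⟩ : ∃ ρ : Fin n ⊕ Fin n → ℕ, Function.Injective ρ :=
    ⟨fun v => Fintype.equivFin _ v, fun x y h =>
      (Fintype.equivFin _).injective (Fin.val_injective h)⟩
  have hsum : ∀ b : (Fin n ⊕ Fin n) →₀ ℕ,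
      (b.sum fun _ e => (e : ℤ)) = ∑ v, (b v : ℤ) := fun b =>
    Finsupp.sum_fintype _ _ fun _ => by simp
  refine ⟨?_, ?_⟩
  · obtain ⟨q, hq⟩ : ∃ q, q + 3 = 2 * n := ⟨2 * n - 3, by omega⟩
    set a : (Fin n ⊕ Fin n) →₀ ℕ := Finsupp.equivFunOnFinite.symm (Sum.elim (fun _ => 1) w)
      with ha
    have h1 := Crown.lower (K := K) hn w hw ρ hρ a q hq (fun i => by simp [ha])
      (fun j => by simp [ha])
    rw [Crown.betti_iff' w ρ hρ hI F a q] at h1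
    push Not at h1
    obtain ⟨j, hj⟩ := h1
    refine ⟨q, j, ?_⟩
    rw [hj, hsum, Fintype.sum_sum_type]
    simp [ha]
    omega
  · intro i j
    by_contra h
    rw [not_le, hsum] at h
    exact (Crown.betti_iff' w ρ hρ hI F _ i).1 (Crown.upper w hw ρ hρ _ i h) j rfl
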